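/- Let S_n(ℓ, r) be the set of permutations in S_n having at least r cycles whose length is divisible by 3 and at least 3ℓ. For fixed positive integers ℓ, r, the proportion |S_n(ℓ,r)|/n! tends to 1 as n → ∞. -/

import Mathlib

open Filter

/-- analytic core -/
theorem core (b : ℕ → ℝ) (L : ℕ) (c : ℕ → ℝ) (hb0 : ∀ n, 0 ≤ b n) (hb00 : b 0 = 1)
    (hc0 : ∀ m, 0 ≤ c m) (hc1 : ∀ m, c m ≤ 1) (hc : ∀ m, L ≤ m → c m + c (m+1) + c (m+2) ≤ 5/2)
    (hrec : ∀ n : ℕ, (n : ℝ) * b n = ∑ j ∈ Finset.range n, c (n - j) * b j) :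
    Tendsto b atTop (nhds 0) := by
  set S : ℕ → ℝ := fun n => ∑ j ∈ Finset.range n, b j with hS
  have hS0 : ∀ n, 0 ≤ S n := fun n => Finset.sum_nonneg fun j _ => hb0 j
  have hSs : ∀ n, S (n+1) = S n + b n := fun n => Finset.sum_range_succ b n
  have hle : ∀ n : ℕ, (n:ℝ) * b n ≤ S n := by
    intro n
    rw [hrec]
    apply Finset.sum_le_sum
    intro j _
    nlinarith [hb0 j, hc1 (n-j)]
  have hb1 : ∀ n, b n ≤ 1 := by
    intro n
    induction n using Nat.strong_induction_on with
    | _ n ih =>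
      rcases Nat.eq_zero_or_pos n with h | h
      · subst h; exact hb00.le
      · have h1 : S n ≤ n := by
          calc S n ≤ ∑ j ∈ Finset.range n, (1:ℝ) := 
                Finset.sum_le_sum fun j hj => ih j (Finset.mem_range.1 hj)
            _ = n := by simp
        have h2 : (0:ℝ) < n := by exact_mod_cast h
        have := hle n
        by_contra hcon
        push Not at hcon
        nlinarith
  set T : ℕ → ℝ := fun n => S (n+1) / (n+1) with hT
  have hT0 : ∀ n, 0 ≤ T n := fun n => div_nonneg (hS0 _) (by positivity)
  have hTS : ∀ n : ℕ, S (n+1) = (n+1) * T n := by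
    intro n; simp only [hT]; field_simp
  have hbT : ∀ n, b (n+1) ≤ T n := by
    intro n
    simp only [hT]
    rw [le_div_iff₀ (by positivity)]
    have := hle (n+1)
    push_cast at this
    linarith
  have hanti : Antitone T := by
    apply antitone_nat_of_succ_le
    intro n
    have h1 := hTS n
    have h2 := hTS (n+1)
    have h3 := hSs (n+1)
    have h4 := hbT n
    push_cast at h2
    have : (0:ℝ) < (n:ℝ)+1+1 := by positivity
    by_contra hcon
    push Not at hcon
    nlinarith
  -- key inequality
  have hkey : ∀ n : ℕ, (n:ℝ) * (S (n+3) - S n) ≤ 5/2 * S n + (3*L + 3) := by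
    intro n
    have e : S (n+3) - S n = b n + b (n+1) + b (n+2) := by
      rw [hSs, hSs, hSs]; ring
    have r0 := hrec n
    have r1 := hrec (n+1)
    have r2 := hrec (n+2)
    rw [Finset.sum_range_succ] at r1
    rw [Finset.sum_range_succ, Finset.sum_range_succ] at r2
    have bd : ∑ j ∈ Finset.range n, c (n - j) * b j + ∑ j ∈ Finset.range n, c (n+1 - j) * b j
       + ∑ j ∈ Finset.range n, c (n+2 - j) * b j ≤ 5/2 * S n + 3 * L := by
      rw [← Finset.sum_add_distrib, ← Finset.sum_add_distrib]
      have hcard : ∑ j ∈ Finset.range n, (if n < j + L then (3:ℝ) else 0) ≤ 3 * L := by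
        rw [← Finset.sum_filter, Finset.sum_const, nsmul_eq_mul]
        have : ((Finset.range n).filter (fun j => n < j + L)).card ≤ L := by
          calc _ ≤ (Finset.Ico (n - L) n).card := by
                apply Finset.card_le_card
                intro j hj
                simp at hj ⊢
                omega
            _ ≤ L := by rw [Nat.card_Ico]; omega
        have : (((Finset.range n).filter (fun j => n < j + L)).card : ℝ) ≤ L := by exact_mod_cast this
        linarith
      calc _ ≤ ∑ j ∈ Finset.range n, (5/2 * b j + if n < j + L then (3:ℝ) else 0) := by
            apply Finset.sum_le_sum
            intro j hj
            have hj := Finset.mem_range.1 hj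
            have e1 : n + 1 - j = (n - j) + 1 := by omega
            have e2 : n + 2 - j = (n - j) + 2 := by omega
            rw [e1, e2]
            split_ifs with h
            · nlinarith [hb0 j, hb1 j, hc1 (n-j), hc1 (n-j+1), hc1 (n-j+2), hc0 (n-j)]
            · have := hc (n-j) (by omega)
              nlinarith [hb0 j]
        _ ≤ _ := by
            rw [Finset.sum_add_distrib, ← Finset.mul_sum]
            linarith
    have q1 : c (n+1-n) * b n ≤ 1 := mul_le_one₀ (hc1 _) (hb0 _) (hb1 _)
    have q2 : c (n+2-n) * b n ≤ 1 := mul_le_one₀ (hc1 _) (hb0 _) (hb1 _)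
    have q3 : c (n+1-n) * b (n+1) ≤ 1 := mul_le_one₀ (hc1 _) (hb0 _) (hb1 _)
    rw [e]
    have e3 : n + 2 - (n+1) = n + 1 - n := by omega
    rw [e3] at r2
    push_cast at r1 r2
    nlinarith [hb0 (n+1), hb0 (n+2)]
  -- limit of T
  have hlim : Tendsto T atTop (nhds (⨅ n, T n)) :=
    tendsto_atTop_ciInf hanti ⟨0, by rintro _ ⟨n, rfl⟩; exact hT0 n⟩
  set d := ⨅ n, T n with hd
  have hdT : ∀ n, d ≤ T n := fun n => ciInf_le ⟨0, by rintro _ ⟨n, rfl⟩; exact hT0 n⟩ n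
  have hd0 : 0 ≤ d := le_ciInf hT0
  have hdz : d = 0 := by
    by_contra hne
    have hdpos : 0 < d := lt_of_le_of_ne hd0 (Ne.symm hne)
    obtain ⟨K, hK⟩ := exists_nat_gt ((3*L+3) * 4 / d)
    have hstep : ∀ n, K ≤ n → d / 4 * (1 / ((n:ℝ) + 4)) ≤ T n - T (n+3) := by
      intro n hn
      have h1 := hkey (n+1)
      have h2 := hTS n
      have h3 := hTS (n+3)
      have h4 : n + 1 + 3 = n + 3 + 1 := by ring
      rw [h4, h3, h2] at h1
      push_cast at h1
      have hn' : (K:ℝ) ≤ n := by exact_mod_cast hn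
      have h5 : (3*L+3) * 4 / d < n := lt_of_lt_of_le hK hn'
      rw [div_lt_iff₀ hdpos] at h5
      have h6 := hdT n
      have hp : (0:ℝ) < (n:ℝ) + 4 := by positivity
      rw [mul_one_div, div_le_iff₀ hp]
      have hp1 : (0:ℝ) < (n:ℝ) + 1 := by positivity
      have : ((n:ℝ)+1) * (d/4) ≤ (n+1) * ((T n - T (n+3)) * (n+4)) := by
        nlinarith
      exact le_of_mul_le_mul_left this hp1
    have hsum : Summable (fun k : ℕ => d / 4 * (1 / (((K + 3 * k : ℕ):ℝ) + 4))) := by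
      apply summable_of_sum_range_le (c := T K)
      · intro k; positivity
      · intro N
        have : ∑ k ∈ Finset.range N, d / 4 * (1 / (((K + 3 * k : ℕ):ℝ) + 4)) ≤
            ∑ k ∈ Finset.range N, (T (K + 3 * k) - T (K + 3 * (k+1))) :=
          Finset.sum_le_sum fun k _ => hstep (K + 3 * k) (by omega)
        rw [Finset.sum_range_sub' (fun k => T (K + 3 * k))] at this
        have h0 := hT0 (K + 3 * N)
        simp only [mul_zero, add_zero] at this
        linarith
    have hs2 : Summable (fun k : ℕ => 1 / ((k + 1 : ℕ) : ℝ)) := by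
      refine Summable.of_nonneg_of_le (fun k => by positivity) ?_
        (hsum.mul_left ((K + 4 + 3) * (4 / d)))
      intro k
      have e : ((K:ℝ) + 4 + 3) * (4 / d) * (d / 4 * (1 / (((K + 3 * k : ℕ):ℝ) + 4)))
        = (K + 4 + 3) / (K + 3 * k + 4) := by
        push_cast
        field_simp
      rw [e, div_le_div_iff₀ (by positivity) (by positivity)]
      push_cast
      nlinarith [mul_nonneg (Nat.cast_nonneg (α := ℝ) K) (Nat.cast_nonneg (α := ℝ) k),
        Nat.cast_nonneg (α := ℝ) k]
    exact Real.not_summable_one_div_natCast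
      ((summable_nat_add_iff (f := fun k : ℕ => 1 / (k:ℝ)) 1).1 hs2)
  rw [hdz] at hlim
  rw [← tendsto_add_atTop_iff_nat 1]
  exact squeeze_zero (fun n => hb0 _) hbT hlim

/-- multisets of positive naturals with sum `n` -/
noncomputable def partSet (n : ℕ) : Finset (Multiset ℕ) :=
  (Finset.univ : Finset n.Partition).image Nat.Partition.parts

theorem mem_partSet {n : ℕ} {s : Multiset ℕ} :
    s ∈ partSet n ↔ (∀ i ∈ s, 0 < i) ∧ s.sum = n := by
  constructor
  · intro h
    obtain ⟨p, -, rfl⟩ := Finset.mem_image.1 h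
    exact ⟨fun i hi => p.parts_pos hi, p.parts_sum⟩
  · rintro ⟨h1, h2⟩
    exact Finset.mem_image.2 ⟨⟨s, fun {i} hi => h1 i hi, h2⟩, Finset.mem_univ _, rfl⟩

/-- size of the centralizer of a permutation with given cycle lengths -/
noncomputable def zsize (s : Multiset ℕ) : ℕ := s.prod * ∏ i ∈ s.toFinset, (s.count i).factorial

theorem zsize_pos {s : Multiset ℕ} (h : ∀ i ∈ s, 0 < i) : 0 < zsize s := by
  have : 0 < s.prod := Multiset.prod_pos h
  unfold zsize
  positivity

theorem zsize_cons (m : ℕ) (t : Multiset ℕ) :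
    zsize (m ::ₘ t) = m * (m ::ₘ t).count m * zsize t := by
  unfold zsize
  rw [Multiset.prod_cons]
  have h1 : ∏ i ∈ (m ::ₘ t).toFinset, ((m ::ₘ t).count i).factorial
      = (m ::ₘ t).count m * ∏ i ∈ (m ::ₘ t).toFinset, (t.count i).factorial := by
    have hm : m ∈ (m ::ₘ t).toFinset := by simp
    rw [← Finset.mul_prod_erase _ _ hm, ← Finset.mul_prod_erase _ _ hm, ← mul_assoc]
    congr 1
    · rw [Multiset.count_cons_self, Nat.factorial_succ]
    · apply Finset.prod_congr rfl
      intro i hi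
      rw [Multiset.count_cons_of_ne (Finset.ne_of_mem_erase hi)]
  have h2 : ∏ i ∈ (m ::ₘ t).toFinset, (t.count i).factorial
      = ∏ i ∈ t.toFinset, (t.count i).factorial := by
    symm
    apply Finset.prod_subset
    · intro i; simp; tauto
    · intro i _ hi
      have : i ∉ t := by simpa using hi
      simp [Multiset.count_eq_zero_of_notMem this]
  rw [h1, h2]
  ring

noncomputable def wt (P : ℕ → Prop) [DecidablePred P] (s : Multiset ℕ) : ℝ :=
  (1/2 : ℝ) ^ (Multiset.card (s.filter P)) / (zsize s : ℝ)

noncomputable def aseq (P : ℕ → Prop) [DecidablePred P] (n : ℕ) : ℝ := ∑ s ∈ partSet n, wt P s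

theorem wt_cons (P : ℕ → Prop) [DecidablePred P] (m : ℕ) (t : Multiset ℕ) (hm : 0 < m) :
    ((m * (m ::ₘ t).count m : ℕ) : ℝ) * wt P (m ::ₘ t) = (if P m then 1/2 else 1) * wt P t := by
  unfold wt
  rw [zsize_cons, Multiset.filter_cons, Multiset.card_add, pow_add]
  have : ((m * (m ::ₘ t).count m : ℕ) : ℝ) ≠ 0 := by
    rw [Multiset.count_cons_self]; positivity
  rw [Nat.cast_mul _ (zsize t), mul_div_mul_comm, ← mul_assoc, mul_div_cancel₀ _ this]
  split_ifs <;> simp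

theorem aseq_rec (P : ℕ → Prop) [DecidablePred P] (n : ℕ) :
    (n : ℝ) * aseq P n = ∑ j ∈ Finset.range n, (if P (n - j) then (1/2:ℝ) else 1) * aseq P j := by
  unfold aseq
  have h1 : (n:ℝ) * ∑ s ∈ partSet n, wt P s
      = ∑ s ∈ partSet n, ∑ m ∈ s.toFinset, ((m * s.count m : ℕ) : ℝ) * wt P s := by
    rw [Finset.mul_sum]
    apply Finset.sum_congr rfl
    intro s hs
    rw [← Finset.sum_mul, ← Nat.cast_sum]
    congr 2
    rw [← (mem_partSet.1 hs).2, Finset.sum_multiset_count]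
    exact Finset.sum_congr rfl fun i _ => by rw [smul_eq_mul, mul_comm]
  rw [h1]
  simp_rw [Finset.mul_sum]
  rw [Finset.sum_sigma', Finset.sum_sigma']
  refine Finset.sum_bij' (fun x _ => ⟨n - x.2, x.1.erase x.2⟩)
    (fun y _ => ⟨(n - y.1) ::ₘ y.2, n - y.1⟩) ?_ ?_ ?_ ?_ ?_
  · rintro ⟨s, m⟩ h
    simp only [Finset.mem_sigma, mem_partSet, Multiset.mem_toFinset, Finset.mem_range] at h ⊢
    obtain ⟨⟨h1, h2⟩, h3⟩ := h
    have h4 := Multiset.sum_erase h3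
    have := h1 m h3
    refine ⟨by omega, fun i hi => h1 i (Multiset.mem_of_mem_erase hi), by omega⟩
  · rintro ⟨j, t⟩ h
    simp only [Finset.mem_sigma, mem_partSet, Multiset.mem_toFinset, Finset.mem_range] at h ⊢
    obtain ⟨h1, h2, h3⟩ := h
    refine ⟨⟨?_, ?_⟩, by simp⟩
    · intro i hi
      rcases Multiset.mem_cons.1 hi with rfl | hi
      · omega
      · exact h2 i hi
    · rw [Multiset.sum_cons]; omega
  · rintro ⟨s, m⟩ h
    simp only [Finset.mem_sigma, mem_partSet, Multiset.mem_toFinset] at h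
    obtain ⟨⟨h1, h2⟩, h3⟩ := h
    have h4 := Multiset.sum_erase h3
    have e : n - (n - m) = m := by omega
    simp only [e, Multiset.cons_erase h3]
  · rintro ⟨j, t⟩ h
    simp only [Finset.mem_sigma, mem_partSet, Finset.mem_range] at h
    have e : n - (n - j) = j := by omega
    simp only [e, Multiset.erase_cons_head]
  · rintro ⟨s, m⟩ h
    simp only [Finset.mem_sigma, mem_partSet, Multiset.mem_toFinset] at h
    obtain ⟨⟨h1, h2⟩, h3⟩ := h
    have h4 := Multiset.sum_erase h3
    have e : n - (n - m) = m := by omega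
    have := wt_cons P m (s.erase m) (h1 m h3)
    rw [Multiset.cons_erase h3] at this
    simp only [e]
    exact this

theorem aseq_nonneg (P : ℕ → Prop) [DecidablePred P] (n : ℕ) : 0 ≤ aseq P n :=
  Finset.sum_nonneg fun s _ => by unfold wt; positivity

theorem aseq_zero (P : ℕ → Prop) [DecidablePred P] : aseq P 0 = 1 := by
  have : partSet 0 = {0} := by
    ext s
    rw [mem_partSet, Finset.mem_singleton]
    constructor
    · rintro ⟨h1, h2⟩
      rw [Multiset.sum_eq_zero_iff] at h2
      apply Multiset.eq_zero_of_forall_notMem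
      intro a ha
      have := h1 a ha
      have := h2 a ha
      omega
    · rintro rfl; simp
  simp [aseq, this, wt, zsize]

theorem zsize_add_ones (k : ℕ) (s : Multiset ℕ) (h : ∀ i ∈ s, 2 ≤ i) :
    zsize (s + Multiset.replicate k 1) = k.factorial * zsize s := by
  induction k with
  | zero => simp
  | succ k ih =>
    rw [Multiset.replicate_succ, Multiset.add_cons, zsize_cons, ih, Multiset.count_cons_self,
      Multiset.count_add, Multiset.count_replicate_self, Multiset.count_eq_zero_of_notMem,
      Nat.factorial_succ]
    · ring
    · intro h1; have := h 1 h1; omega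

theorem fiber_card (n : ℕ) (s : Multiset ℕ) (hs : s ∈ partSet n) :
    (Finset.univ.filter fun w : Equiv.Perm (Fin n) => w.partition.parts = s).card * zsize s
      = n.factorial := by
  obtain ⟨h1, h2⟩ := mem_partSet.1 hs
  set m := s.filter (fun i => 2 ≤ i) with hm
  have hm2 : ∀ i ∈ m, 2 ≤ i := fun i hi => (Multiset.mem_filter.1 hi).2
  have hdec : s = m + Multiset.replicate (n - m.sum) 1 := by
    have e1 : s.filter (fun i => ¬ 2 ≤ i) 
        = Multiset.replicate (Multiset.card (s.filter (fun i => ¬ 2 ≤ i))) 1 := by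
      rw [Multiset.eq_replicate]
      refine ⟨rfl, fun i hi => ?_⟩
      have := Multiset.mem_filter.1 hi
      have := h1 i this.1
      omega
    have e2 := Multiset.filter_add_not (fun i => 2 ≤ i) s
    rw [e1, ← hm] at e2
    have e3 := congrArg Multiset.sum e2
    rw [Multiset.sum_add, Multiset.sum_replicate, h2, smul_eq_mul, mul_one] at e3
    have e4 : n - m.sum = Multiset.card (s.filter (fun i => ¬ 2 ≤ i)) := by omega
    rw [e4]
    exact e2.symm
  have hsum : m.sum ≤ n := by
    have := congrArg Multiset.sum hdec
    rw [Multiset.sum_add, h2] at this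
    omega
  have hf : (Finset.univ.filter fun w : Equiv.Perm (Fin n) => w.partition.parts = s)
      = Finset.univ.filter fun w : Equiv.Perm (Fin n) => w.cycleType = m := by
    ext w
    simp only [Finset.mem_filter, Finset.mem_univ, true_and]
    constructor
    · intro h
      rw [← Equiv.Perm.filter_parts_partition_eq_cycleType, h]
    · intro h
      rw [Equiv.Perm.parts_partition, ← Equiv.Perm.sum_cycleType, h, Fintype.card_fin]
      exact hdec.symm
  have hz : zsize s = (n - m.sum).factorial * zsize m := by
    conv_lhs => rw [hdec]
    exact zsize_add_ones _ _ hm2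
  have := Equiv.Perm.card_of_cycleType_mul_eq (Fin n) m
  rw [Fintype.card_fin, if_pos ⟨hsum, hm2⟩] at this
  rw [hf, hz, ← this, zsize]
  ring

theorem sum_perm (P : ℕ → Prop) [DecidablePred P] (hP : ¬ P 1) (n : ℕ) :
    ∑ w : Equiv.Perm (Fin n), (1/2 : ℝ) ^ (Multiset.card (w.cycleType.filter P))
      = n.factorial * aseq P n := by
  have h1 : ∀ w : Equiv.Perm (Fin n), w.partition.parts ∈ partSet n := by
    intro w
    refine mem_partSet.2 ⟨fun i hi => w.partition.parts_pos hi, ?_⟩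
    rw [w.partition.parts_sum, Fintype.card_fin]
  rw [← Finset.sum_fiberwise_of_maps_to (s := Finset.univ) (t := partSet n)
    (g := fun w : Equiv.Perm (Fin n) => w.partition.parts) (fun w _ => h1 w)]
  unfold aseq
  rw [Finset.mul_sum]
  apply Finset.sum_congr rfl
  intro s hs
  have h2 : ∀ w ∈ (Finset.univ.filter fun w : Equiv.Perm (Fin n) => w.partition.parts = s),
      (1/2 : ℝ) ^ (Multiset.card (w.cycleType.filter P))
        = (1/2 : ℝ) ^ (Multiset.card (s.filter P)) := by
    intro w hw
    rw [← (Finset.mem_filter.1 hw).2, Equiv.Perm.parts_partition, Multiset.filter_add]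
    rw [Multiset.filter_eq_nil (s := Multiset.replicate _ _) |>.2, add_zero]
    intro a ha
    rw [Multiset.eq_of_mem_replicate ha]
    exact hP
  rw [Finset.sum_congr rfl h2, Finset.sum_const, nsmul_eq_mul, ← fiber_card n s hs, wt]
  have := zsize_pos (mem_partSet.1 hs).1
  push_cast
  field_simp

/-- Let `S_n(ℓ, r)` be the set of permutations in `S_n` having at least `r` cycles whose
length is divisible by `3` and at least `3ℓ`. For fixed positive integers `ℓ` and `r`,
the proportion `|S_n(ℓ, r)| / n!` tends to `1` as `n → ∞`. -/
theorem proportion_with_many_long_cycles_tendsto_one (ℓ r : ℕ) (hℓ : 0 < ℓ) (hr : 0 < r) :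
    Tendsto (fun n : ℕ =>
      (Nat.card {w : Equiv.Perm (Fin n) //
          r ≤ Multiset.card ((Equiv.Perm.cycleType w).filter fun m => 3 ∣ m ∧ 3 * ℓ ≤ m)} : ℝ)
        / (n.factorial : ℝ))
      atTop (nhds 1) := by
  set P : ℕ → Prop := fun m => 3 ∣ m ∧ 3 * ℓ ≤ m with hPdef
  have hlim : Tendsto (aseq P) atTop (nhds 0) := by
    refine core (aseq P) (3 * ℓ) (fun m => if P m then (1/2:ℝ) else 1) (aseq_nonneg P)
      (aseq_zero P) ?_ ?_ ?_ (aseq_rec P)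
    · intro m; split_ifs <;> norm_num
    · intro m; split_ifs <;> norm_num
    · intro m hm
      have : P m ∨ P (m+1) ∨ P (m+2) := by
        simp only [hPdef]; omega
      split_ifs <;> first | tauto | norm_num
  have hlow : Tendsto (fun n => 1 - 2 ^ r * aseq P n) atTop (nhds 1) := by
    simpa using (hlim.const_mul (2 ^ r : ℝ)).const_sub 1
  have hcard : ∀ n : ℕ, (Nat.card {w : Equiv.Perm (Fin n) //
      r ≤ Multiset.card ((Equiv.Perm.cycleType w).filter P)} : ℝ)
      = ∑ w : Equiv.Perm (Fin n),
        if r ≤ Multiset.card ((Equiv.Perm.cycleType w).filter P) then (1:ℝ) else 0 := by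
    intro n
    rw [Nat.card_eq_fintype_card, Fintype.card_subtype, Finset.sum_boole]
  have hone : ∀ n : ℕ, (n.factorial : ℝ) = ∑ w : Equiv.Perm (Fin n), (1:ℝ) := by
    intro n
    simp [Fintype.card_perm]
  refine tendsto_of_tendsto_of_tendsto_of_le_of_le hlow tendsto_const_nhds ?_ ?_
  · intro n
    have hn : (0:ℝ) < n.factorial := by exact_mod_cast n.factorial_pos
    dsimp only
    rw [le_div_iff₀ hn, hcard, sub_mul, one_mul, mul_assoc, mul_comm (aseq P n),
      ← sum_perm P (by simp only [hPdef]; omega), hone, Finset.mul_sum, ← Finset.sum_sub_distrib]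
    apply Finset.sum_le_sum
    intro w _
    split_ifs with h
    · have : (0:ℝ) ≤ 2 ^ r * (1/2) ^ (Multiset.card ((Equiv.Perm.cycleType w).filter P)) := by
        positivity
      linarith
    · push Not at h
      have h3 : (1/2:ℝ) ^ r ≤ (1/2) ^ (Multiset.card ((Equiv.Perm.cycleType w).filter P)) :=
        pow_le_pow_of_le_one (by norm_num) (by norm_num) h.le
      have h4 : (2:ℝ) ^ r * (1/2) ^ r = 1 := by rw [← mul_pow]; norm_num
      have h5 := mul_le_mul_of_nonneg_left h3 (by positivity : (0:ℝ) ≤ 2 ^ r)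
      linarith
  · intro n
    have hn : (0:ℝ) < n.factorial := by exact_mod_cast n.factorial_pos
    dsimp only
    rw [div_le_one hn, hcard, hone]
    apply Finset.sum_le_sum
    intro w _
    split_ifs <;> norm_num
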